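/- For every natural number j ≥ 3, the quantity ⌊S(j)·S(j+2) / (j·(j+2))⌋ equals 1 if both j and j+2 are prime, and equals 0 otherwise. -/

import Mathlib

/-- The classical Smarandache function: `S n` is the smallest positive integer `m`
such that `n` divides `m!` (this gives `S 1 = 1`). -/
noncomputable def smarandache (n : ℕ) : ℕ := sInf {m : ℕ | 0 < m ∧ n ∣ Nat.factorial m}

theorem smarandache_le {n m : ℕ} (hm : 0 < m) (h : n ∣ m.factorial) : smarandache n ≤ m :=
  Nat.sInf_le ⟨hm, h⟩

theorem smarandache_le_self {n : ℕ} (hn : 0 < n) : smarandache n ≤ n :=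
  smarandache_le hn (Nat.dvd_factorial hn le_rfl)

theorem smarandache_of_prime {p : ℕ} (hp : p.Prime) : smarandache p = p := by
  refine (smarandache_le_self hp.pos).antisymm (le_csInf ?_ ?_)
  · exact ⟨p, hp.pos, Nat.dvd_factorial hp.pos le_rfl⟩
  · rintro m ⟨-, hm⟩
    exact hp.dvd_factorial.1 hm

theorem mul_dvd_factorial_of_lt {a b : ℕ} (ha : 0 < a) (hab : a < b) : a * b ∣ b.factorial := by
  rw [mul_comm, ← Nat.mul_factorial_pred (by lia)]
  exact mul_dvd_mul_left b (Nat.dvd_factorial ha (by lia))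

theorem dvd_factorial_pred_of_not_prime {n : ℕ} (hn : 4 < n) (hp : ¬ n.Prime) :
    n ∣ (n - 1).factorial := by
  obtain ⟨b, hb⟩ := n.minFac_dvd
  have ha : 2 ≤ n.minFac := (Nat.minFac_prime (by lia)).two_le
  have hsq : n.minFac ^ 2 ≤ n := Nat.minFac_sq_le_self (by lia) hp
  generalize n.minFac = a at hb ha hsq
  have hab : a ≤ b := by nlinarith
  rcases hab.lt_or_eq with hlt | rfl
  · have hbn : b ≤ n - 1 := Nat.le_sub_one_of_lt (by nlinarith)
    have h := (mul_dvd_factorial_of_lt (by lia) hlt).trans (Nat.factorial_dvd_factorial hbn)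
    rwa [← hb] at h
  · have ha' : 3 ≤ a := by
      by_contra! h
      have : a = 2 := by lia
      subst this
      lia
    have han : 2 * a ≤ n - 1 := Nat.le_sub_one_of_lt (by nlinarith)
    have hdvd : a * a ∣ a * (2 * a) := mul_dvd_mul_left a (dvd_mul_left a 2)
    have h := (hdvd.trans (mul_dvd_factorial_of_lt (by lia) (by lia))).trans
      (Nat.factorial_dvd_factorial han)
    rwa [← hb] at h

theorem smarandache_lt_self_of_not_prime {n : ℕ} (hn : 4 < n) (hp : ¬ n.Prime) :
    smarandache n < n :=
  (smarandache_le (by lia) (dvd_factorial_pred_of_not_prime hn hp)).trans_lt (by lia)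

theorem twin_prime_indicator (j : ℕ) (hj : 3 ≤ j) :
    smarandache j * smarandache (j + 2) / (j * (j + 2))
      = if Nat.Prime j ∧ Nat.Prime (j + 2) then 1 else 0 := by
  have hle : smarandache j ≤ j := smarandache_le_self (by lia)
  have hle' : smarandache (j + 2) ≤ j + 2 := smarandache_le_self (by lia)
  split_ifs with h
  · rw [smarandache_of_prime h.1, smarandache_of_prime h.2]
    exact Nat.div_self (by positivity)
  · apply Nat.div_eq_of_lt
    by_cases hp : (j + 2).Prime
    · have hj4 : j ≠ 4 := by
        rintro rfl
        norm_num at hp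
      have hj3 : j ≠ 3 := by
        rintro rfl
        norm_num at h
      have hlt : smarandache j < j :=
        smarandache_lt_self_of_not_prime (by lia) fun hj' => h ⟨hj', hp⟩
      exact Nat.mul_lt_mul_of_lt_of_le hlt hle' (by lia)
    · exact Nat.mul_lt_mul_of_le_of_lt hle (smarandache_lt_self_of_not_prime (by lia) hp) (by lia)
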